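/- Let n ≥ 3, 1 < p < ∞, and let Ω ⊆ ℝⁿ be a bounded connected open set such that ℝⁿ∖Ω is uniformly p-fat with constants c₀ and r₀. Then there is a constant C > 0 such that for all φ ∈ C_c^∞(Ω) one has the Hardy inequality ∫_Ω |φ(x)|^p δ(x)^{−p} dx ≤ C ∫_Ω |∇φ(x)|^p dx. -/

import Mathlib

open MeasureTheory Metric
open scoped NNReal ENNReal

/-- The variational `p`-capacity of the condenser `(K, U)`: the infimum of `∫_U |∇φ|^p`
over Lipschitz functions `φ` with compact support contained in `U` with `φ ≥ 1` on `K`. -/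
noncomputable def pCap (n : ℕ) (p : ℝ) (K U : Set (EuclideanSpace ℝ (Fin n))) : ℝ :=
  sInf { c : ℝ | ∃ φ : EuclideanSpace ℝ (Fin n) → ℝ, (∃ L : ℝ≥0, LipschitzWith L φ) ∧
    HasCompactSupport φ ∧ tsupport φ ⊆ U ∧ (∀ x ∈ K, 1 ≤ φ x) ∧
    c = ∫ x in U, ‖fderiv ℝ φ x‖ ^ p }

/-- A closed set `E ⊆ ℝⁿ` is uniformly `p`-fat with constants `c₀, r₀ > 0` if
`cap_p(E ∩ B̄(x,r), B(x,2r)) ≥ c₀ · cap_p(B̄(x,r), B(x,2r))` for all `x ∈ ∂E`, `0 < r ≤ r₀`. -/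
def UniformlyFat (n : ℕ) (p c₀ r₀ : ℝ) (E : Set (EuclideanSpace ℝ (Fin n))) : Prop :=
  ∀ x ∈ frontier E, ∀ r : ℝ, 0 < r → r ≤ r₀ →
    c₀ * pCap n p (closedBall x r) (ball x (2 * r)) ≤
      pCap n p (E ∩ closedBall x r) (ball x (2 * r))

/-- Jensen's inequality for powers on a probability space. -/
theorem rpow_lintegral_le_lintegral_rpow {α : Type*} [MeasurableSpace α] {μ : Measure α}
    [IsProbabilityMeasure μ] {f : α → ℝ≥0∞} (hf : AEMeasurable f μ) {p : ℝ} (hp : 1 ≤ p) :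
    (∫⁻ a, f a ∂μ) ^ p ≤ ∫⁻ a, f a ^ p ∂μ := by
  have hp0 : 0 < p := by linarith
  have h := eLpNorm'_le_eLpNorm'_of_exponent_le (μ := μ) (f := f) one_pos hp hf.aestronglyMeasurable
  simp only [eLpNorm'_eq_lintegral_enorm, enorm_eq_self, ENNReal.rpow_one, div_one] at h
  calc _ ≤ ((∫⁻ a, f a ^ p ∂μ) ^ (1 / p)) ^ p := by gcongr
    _ = _ := by rw [← ENNReal.rpow_mul, one_div_mul_cancel hp0.ne', ENNReal.rpow_one]

section Poincare

variable {E : Type*} [NormedAddCommGroup E] [NormedSpace ℝ E]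

/-- The increment of a Lipschitz function along almost every translate of a segment is controlled
by the integral of its gradient over that segment. -/
theorem LipschitzWith.ae_enorm_sub_le_lintegral_fderiv [FiniteDimensional ℝ E] [MeasurableSpace E]
    [BorelSpace E] (μ : Measure E) [μ.IsAddHaarMeasure] {u : E → ℝ} {L : ℝ≥0}
    (hu : LipschitzWith L u) (h : E) :
    ∀ᵐ x ∂μ, ‖u (x + h) - u x‖ₑ ≤
      ∫⁻ t in Set.Ioc (0 : ℝ) 1, ‖h‖ₑ * ‖fderiv ℝ u (x + t • h)‖ₑ := by
  have hm : MeasurableSet {z : E × ℝ | DifferentiableAt ℝ u (z.1 + z.2 • h)} :=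
    (by fun_prop : Measurable fun z : E × ℝ => z.1 + z.2 • h)
      (measurableSet_of_differentiableAt ℝ u)
  have hae : ∀ᵐ x ∂μ, ∀ᵐ t : ℝ, DifferentiableAt ℝ u (x + t • h) := by
    rw [Measure.ae_ae_comm hm]
    exact .of_forall fun t =>
      (measurePreserving_add_right μ (t • h)).quasiMeasurePreserving.ae hu.ae_differentiableAt
  filter_upwards [hae] with x hx
  set f : ℝ → ℝ := fun t => u (x + t • h) with hf
  have hL : LipschitzWith (L * ‖h‖₊) f := by
    refine LipschitzWith.of_dist_le_mul fun s t => ?_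
    refine (hu.dist_le_mul _ _).trans_eq ?_
    rw [dist_add_left, dist_eq_norm, ← sub_smul, norm_smul, Real.dist_eq, Real.norm_eq_abs]
    push_cast
    ring
  have key := (hL.lipschitzOnWith (s := Set.uIcc 0 1)).absolutelyContinuousOnInterval
    |>.integral_deriv_eq_sub
  have e : u (x + h) - u x = ∫ t in Set.Ioc (0 : ℝ) 1, deriv f t := by
    rw [← intervalIntegral.integral_of_le zero_le_one, key]
    simp [hf]
  rw [e]
  refine (enorm_integral_le_lintegral_enorm _).trans ?_
  refine lintegral_mono_ae (ae_restrict_of_ae ?_)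
  filter_upwards [hx] with t ht
  have hd : HasDerivAt f (fderiv ℝ u (x + t • h) h) t := by
    refine ht.hasFDerivAt.comp_hasDerivAt t ?_
    simpa using ((hasDerivAt_id t).smul_const h).const_add x
  rw [hd.deriv, mul_comm]
  exact (fderiv ℝ u (x + t • h)).le_opENorm h

/-- Translation estimate for Lipschitz functions. -/
theorem LipschitzWith.lintegral_enorm_sub_rpow_le [FiniteDimensional ℝ E] [MeasurableSpace E]
    [BorelSpace E] (μ : Measure E) [μ.IsAddHaarMeasure] {u : E → ℝ} {L : ℝ≥0}
    (hu : LipschitzWith L u) {p : ℝ} (hp : 1 ≤ p) (h : E) {S T : Set E} (hS : MeasurableSet S)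
    (hT : MeasurableSet T) (hST : ∀ x ∈ S, ∀ t ∈ Set.Ioc (0 : ℝ) 1, x + t • h ∈ T) :
    ∫⁻ x in S, ‖u (x + h) - u x‖ₑ ^ p ∂μ ≤ ‖h‖ₑ ^ p * ∫⁻ x in T, ‖fderiv ℝ u x‖ₑ ^ p ∂μ := by
  have hp0 : 0 ≤ p := by linarith
  have hG : Measurable fun x => ‖fderiv ℝ u x‖ₑ := (measurable_fderiv ℝ u).enorm
  have : IsProbabilityMeasure (volume.restrict (Set.Ioc (0 : ℝ) 1)) := ⟨by simp⟩
  have hmeas : Measurable fun z : E × ℝ => ‖fderiv ℝ u (z.1 + z.2 • h)‖ₑ ^ p :=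
    (hG.comp (by fun_prop : Measurable fun z : E × ℝ => z.1 + z.2 • h)).pow_const p
  calc ∫⁻ x in S, ‖u (x + h) - u x‖ₑ ^ p ∂μ
      ≤ ∫⁻ x in S, (∫⁻ t in Set.Ioc (0 : ℝ) 1, ‖h‖ₑ ^ p * ‖fderiv ℝ u (x + t • h)‖ₑ ^ p) ∂μ := by
        refine lintegral_mono_ae (ae_restrict_of_ae ?_)
        filter_upwards [hu.ae_enorm_sub_le_lintegral_fderiv μ h] with x hx
        refine (ENNReal.rpow_le_rpow hx hp0).trans ?_
        refine (rpow_lintegral_le_lintegral_rpow ?_ hp).trans_eq ?_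
        · exact ((hG.comp
          (by fun_prop : Measurable fun t : ℝ => x + t • h)).const_mul _).aemeasurable
        · simp_rw [ENNReal.mul_rpow_of_nonneg _ _ hp0]
    _ = ∫⁻ t in Set.Ioc (0 : ℝ) 1, (∫⁻ x in S, ‖h‖ₑ ^ p * ‖fderiv ℝ u (x + t • h)‖ₑ ^ p ∂μ) :=
        lintegral_lintegral_swap (hmeas.const_mul _).aemeasurable
    _ ≤ ∫⁻ _ in Set.Ioc (0 : ℝ) 1, ‖h‖ₑ ^ p * ∫⁻ x in T, ‖fderiv ℝ u x‖ₑ ^ p ∂μ := by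
        refine setLIntegral_mono measurable_const fun t ht => ?_
        have hmt : Measurable fun x : E => ‖fderiv ℝ u (x + t • h)‖ₑ ^ p :=
          (hG.comp (by fun_prop : Measurable fun x : E => x + t • h)).pow_const p
        rw [lintegral_const_mul _ hmt]
        refine mul_le_mul' le_rfl ?_
        rw [← lintegral_indicator hS, ← lintegral_indicator hT,
          ← lintegral_add_right_eq_self (T.indicator _) (t • h)]
        refine lintegral_mono fun x => ?_
        by_cases hx : x ∈ S
        · simp [hx, hST x hx t ht]
        · simp [hx]
    _ = _ := by simp

/-- Friedrichs' inequality for Lipschitz functions vanishing outside a ball. -/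
theorem LipschitzWith.lintegral_enorm_rpow_le_of_eq_zero [FiniteDimensional ℝ E] [Nontrivial E]
    [MeasurableSpace E] [BorelSpace E] (μ : Measure E) [μ.IsAddHaarMeasure] {u : E → ℝ} {L : ℝ≥0}
    (hu : LipschitzWith L u) {p : ℝ} (hp : 1 ≤ p) {z : E} {R : ℝ} (hR : 0 ≤ R)
    (hz : ∀ x ∉ ball z R, u x = 0) :
    ∫⁻ x, ‖u x‖ₑ ^ p ∂μ ≤ ENNReal.ofReal (2 * R) ^ p * ∫⁻ x, ‖fderiv ℝ u x‖ₑ ^ p ∂μ := by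
  have hp0 : 0 < p := by linarith
  obtain ⟨h, hh⟩ := exists_norm_eq E (by positivity : 0 ≤ 2 * R)
  have key := hu.lintegral_enorm_sub_rpow_le μ hp h (S := ball z R) (T := Set.univ)
    measurableSet_ball MeasurableSet.univ (by simp)
  rw [Measure.restrict_univ] at key
  rw [← hh, ofReal_norm]
  refine le_trans ?_ key
  rw [← lintegral_indicator measurableSet_ball]
  refine lintegral_mono fun x => ?_
  by_cases hx : x ∈ ball z R
  · have hxh : x + h ∉ ball z R := by
      intro hxh
      have h1 : dist (x + h) x < 2 * R := by
        linarith [dist_triangle_right (x + h) x z, mem_ball.1 hx, mem_ball.1 hxh]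
      simp [hh] at h1
    simp [hx, hz _ hxh]
  · simp [hx, hz x hx, hp0]

/-- Poincaré's inequality on balls, in its double integral form. -/
theorem LipschitzWith.lintegral_lintegral_enorm_sub_rpow_le [FiniteDimensional ℝ E]
    [MeasurableSpace E] [BorelSpace E] (μ : Measure E) [μ.IsAddHaarMeasure] {u : E → ℝ} {L : ℝ≥0}
    (hu : LipschitzWith L u) {p : ℝ} (hp : 1 ≤ p) (z : E) (R : ℝ) :
    ∫⁻ y in ball z R, (∫⁻ x in ball z R, ‖u y - u x‖ₑ ^ p ∂μ) ∂μ ≤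
      μ (ball 0 (2 * R)) *
        (ENNReal.ofReal (2 * R) ^ p * ∫⁻ x in ball z (3 * R), ‖fderiv ℝ u x‖ₑ ^ p ∂μ) := by
  have hp0 : 0 ≤ p := by linarith
  have huc := hu.continuous
  have hm : Measurable fun w : E × E => ‖u (w.1 + w.2) - u w.1‖ₑ ^ p :=
    (by fun_prop : Continuous fun w : E × E => u (w.1 + w.2) - u w.1).measurable.enorm.pow_const p
  calc _ = ∫⁻ x in ball z R, (∫⁻ y in ball z R, ‖u y - u x‖ₑ ^ p ∂μ) ∂μ := by
        refine lintegral_lintegral_swap ?_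
        exact ((by fun_prop : Continuous fun w : E × E => u w.1 - u w.2).measurable.enorm.pow_const
          p).aemeasurable
    _ ≤ ∫⁻ x in ball z R, (∫⁻ h in ball 0 (2 * R), ‖u (x + h) - u x‖ₑ ^ p ∂μ) ∂μ := by
        refine setLIntegral_mono' measurableSet_ball fun x hx => ?_
        rw [← lintegral_indicator measurableSet_ball, ← lintegral_indicator measurableSet_ball,
          ← lintegral_add_left_eq_self ((ball z R).indicator _) x]
        refine lintegral_mono fun h => ?_
        by_cases hxh : x + h ∈ ball z R
        · have hh : h ∈ ball (0 : E) (2 * R) := by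
            have : dist (x + h) x < 2 * R := by
              linarith [dist_triangle_right (x + h) x z, mem_ball.1 hx, mem_ball.1 hxh]
            simpa using this
          simp [hxh, hh]
        · simp [hxh]
    _ = ∫⁻ h in ball 0 (2 * R), (∫⁻ x in ball z R, ‖u (x + h) - u x‖ₑ ^ p ∂μ) ∂μ :=
        lintegral_lintegral_swap hm.aemeasurable
    _ ≤ ∫⁻ _ in ball (0 : E) (2 * R), (ENNReal.ofReal (2 * R) ^ p *
          ∫⁻ x in ball z (3 * R), ‖fderiv ℝ u x‖ₑ ^ p ∂μ) ∂μ := by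
        refine setLIntegral_mono' measurableSet_ball fun h hh => ?_
        rw [mem_ball_zero_iff] at hh
        refine (hu.lintegral_enorm_sub_rpow_le μ hp h (T := ball z (3 * R)) measurableSet_ball
          measurableSet_ball fun x hx t ht => ?_).trans ?_
        · rw [mem_ball] at hx ⊢
          have h1 : ‖t • h‖ ≤ ‖h‖ := by
            rw [norm_smul, Real.norm_of_nonneg ht.1.le]
            exact mul_le_of_le_one_left (norm_nonneg _) ht.2
          have h2 : dist (x + t • h) x = ‖t • h‖ := by simp
          linarith [dist_triangle (x + t • h) x z]
        · rw [← ofReal_norm]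
          gcongr
    _ = _ := by rw [setLIntegral_const, mul_comm]

end Poincare

/-- The product of two bounded real Lipschitz functions is Lipschitz. -/
theorem LipschitzWith.mul_of_bounded {α : Type*} [PseudoMetricSpace α] {f g : α → ℝ}
    {Kf Kg A B : ℝ≥0} (hf : LipschitzWith Kf f) (hg : LipschitzWith Kg g) (hA : ∀ x, |f x| ≤ A)
    (hB : ∀ x, |g x| ≤ B) : LipschitzWith (A * Kg + B * Kf) fun x => f x * g x := by
  refine LipschitzWith.of_dist_le_mul fun x y => ?_
  have h1 := hf.dist_le_mul x y
  have h2 := hg.dist_le_mul x y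
  rw [Real.dist_eq] at h1 h2 ⊢
  calc |f x * g x - f y * g y| = |f x * (g x - g y) + g y * (f x - f y)| := by ring_nf
    _ ≤ |f x| * |g x - g y| + |g y| * |f x - f y| := by
        simpa [abs_mul] using abs_add_le (f x * (g x - g y)) (g y * (f x - f y))
    _ ≤ A * (Kg * dist x y) + B * (Kf * dist x y) := by
        gcongr
        · exact hA x
        · exact hB y
    _ = _ := by push_cast; ring

/-- The piecewise affine cutoff function equal to `1` on `closedBall z r` and to `0` off
`ball z (3 / 2 * r)`. -/
noncomputable def ballCutoff {α : Type*} [PseudoMetricSpace α] (z : α) (r : ℝ) (x : α) : ℝ :=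
  max 0 (min 1 (3 - 2 / r * dist x z))

section BallCutoff

variable {α : Type*} [PseudoMetricSpace α] {z x : α} {r : ℝ}

theorem ballCutoff_eq_one (hr : 0 < r) (hx : dist x z ≤ r) : ballCutoff z r x = 1 := by
  have : 2 / r * dist x z ≤ 2 := by
    rw [div_mul_eq_mul_div, div_le_iff₀ hr]; linarith
  rw [ballCutoff, min_eq_left (by linarith), max_eq_right zero_le_one]

theorem ballCutoff_eq_zero (hr : 0 < r) (hx : 3 / 2 * r ≤ dist x z) : ballCutoff z r x = 0 := by
  have : 3 ≤ 2 / r * dist x z := by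
    rw [div_mul_eq_mul_div, le_div_iff₀ hr]; linarith
  rw [ballCutoff, max_eq_left]
  exact (min_le_right _ _).trans (by linarith)

theorem abs_ballCutoff_le_one : |ballCutoff z r x| ≤ 1 := by
  rw [ballCutoff, abs_of_nonneg (le_max_left _ _)]
  exact max_le zero_le_one (min_le_left _ _)

theorem lipschitzWith_ballCutoff (z : α) (r : ℝ) :
    LipschitzWith ‖2 / r‖₊ (ballCutoff z r) := by
  refine LipschitzWith.const_max (LipschitzWith.const_min (LipschitzWith.of_dist_le_mul
    fun x y => ?_) _) _
  rw [Real.dist_eq, show 3 - 2 / r * dist x z - (3 - 2 / r * dist y z) =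
    2 / r * (dist y z - dist x z) by ring, abs_mul, coe_nnnorm, Real.norm_eq_abs, dist_comm x y]
  gcongr
  exact abs_dist_sub_le y x z

theorem tsupport_mul_ballCutoff_subset (hr : 0 < r) (f : α → ℝ) :
    tsupport (fun x => ballCutoff z r x * f x) ⊆ closedBall z (3 / 2 * r) := by
  refine closure_minimal (fun x hx => ?_) isClosed_closedBall
  by_contra h
  rw [mem_closedBall, not_le] at h
  exact hx (by simp [ballCutoff_eq_zero hr h.le])

end BallCutoff

theorem integral_norm_rpow_eq_toReal_lintegral {α F : Type*} [MeasurableSpace α]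
    [NormedAddCommGroup F] {μ : Measure α} {f : α → F} (hf : AEStronglyMeasurable f μ) {p : ℝ}
    (hp : 0 ≤ p) : ∫ x, ‖f x‖ ^ p ∂μ = (∫⁻ x, ‖f x‖ₑ ^ p ∂μ).toReal := by
  rw [integral_eq_lintegral_of_nonneg_ae (.of_forall fun x => by positivity)
    (hf.norm.aemeasurable.pow_const p).aestronglyMeasurable]
  congr 1
  refine lintegral_congr fun x => ?_
  rw [← ENNReal.ofReal_rpow_of_nonneg (norm_nonneg _) hp, ofReal_norm]

theorem pCap_le_integral {n : ℕ} {p : ℝ} {K U : Set (EuclideanSpace ℝ (Fin n))}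
    {φ : EuclideanSpace ℝ (Fin n) → ℝ} {L : ℝ≥0} (hL : LipschitzWith L φ)
    (hc : HasCompactSupport φ) (hU : tsupport φ ⊆ U) (hK : ∀ x ∈ K, 1 ≤ φ x) :
    pCap n p K U ≤ ∫ x in U, ‖fderiv ℝ φ x‖ ^ p := by
  refine csInf_le ⟨0, ?_⟩ ⟨φ, ⟨L, hL⟩, hc, hU, hK, rfl⟩
  rintro _ ⟨ψ, -, -, -, -, rfl⟩
  positivity

/-- The capacity of a ball in the concentric ball of twice the radius is positive. -/
theorem volume_div_le_pCap_closedBall {n : ℕ} [Nontrivial (EuclideanSpace ℝ (Fin n))] {p : ℝ}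
    (hp : 1 ≤ p) (z : EuclideanSpace ℝ (Fin n)) {r : ℝ} (hr : 0 < r) :
    volume.real (ball z r) / (4 * r) ^ p ≤ pCap n p (closedBall z r) (ball z (2 * r)) := by
  have hp0 : 0 < p := by linarith
  refine le_csInf ?_ ?_
  · have hs := tsupport_mul_ballCutoff_subset (z := z) hr fun _ => (1 : ℝ)
    simp only [mul_one] at hs
    refine ⟨_, ballCutoff z r, ⟨_, lipschitzWith_ballCutoff z r⟩,
      (isCompact_closedBall z _).of_isClosed_subset (isClosed_tsupport _) hs,
      hs.trans (closedBall_subset_ball (by linarith)),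
      fun x hx => (ballCutoff_eq_one hr hx).ge, rfl⟩
  · rintro _ ⟨φ, ⟨L, hL⟩, hc, hU, hK, rfl⟩
    rw [integral_norm_rpow_eq_toReal_lintegral
      (measurable_fderiv ℝ φ).aestronglyMeasurable hp0.le]
    have hfin : ∫⁻ x in ball z (2 * r), ‖fderiv ℝ φ x‖ₑ ^ p ≠ ⊤ := by
      refine ((setLIntegral_mono measurable_const fun x _ => ?_).trans_lt
        (?_ : ∫⁻ _ in ball z (2 * r), (L : ℝ≥0∞) ^ p < ⊤)).ne
      · gcongr
        exact_mod_cast norm_fderiv_le_of_lipschitz ℝ hL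
      · rw [setLIntegral_const]
        exact ENNReal.mul_lt_top (ENNReal.rpow_lt_top_of_nonneg hp0.le ENNReal.coe_ne_top)
          measure_ball_lt_top
    have hF := hL.lintegral_enorm_rpow_le_of_eq_zero volume hp (z := z) (R := 2 * r)
      (by positivity) fun x hx => image_eq_zero_of_notMem_tsupport fun h => hx (hU h)
    have hsupp : ∫⁻ x, ‖fderiv ℝ φ x‖ₑ ^ p = ∫⁻ x in ball z (2 * r), ‖fderiv ℝ φ x‖ₑ ^ p := by
      rw [← lintegral_indicator measurableSet_ball, Set.indicator_eq_self.2]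
      refine fun x hx => hU (support_fderiv_subset ℝ fun h => hx ?_)
      change ‖fderiv ℝ φ x‖ₑ ^ p = 0
      rw [← ofReal_norm, h, norm_zero, ENNReal.ofReal_zero, ENNReal.zero_rpow_of_pos hp0]
    rw [hsupp, show 2 * (2 * r) = 4 * r by ring] at hF
    have hV : volume (ball z r) ≤ ∫⁻ x, ‖φ x‖ₑ ^ p := by
      rw [← setLIntegral_one]
      refine (setLIntegral_mono' measurableSet_ball fun x hx => ?_).trans
        (setLIntegral_le_lintegral _ _)
      refine ENNReal.one_le_rpow ?_ hp0
      rw [← enorm_one (G := ℝ)]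
      have := hK x (ball_subset_closedBall hx)
      refine enorm_le_iff_norm_le.2 ?_
      rw [norm_one, Real.norm_eq_abs]
      exact this.trans (le_abs_self _)
    rw [div_le_iff₀' (by positivity), Measure.real]
    have := ENNReal.toReal_mono (ENNReal.mul_ne_top
      (ENNReal.rpow_ne_top_of_nonneg hp0.le ENNReal.ofReal_ne_top) hfin) (hV.trans hF)
    rwa [ENNReal.toReal_mul, ENNReal.ofReal_rpow_of_pos (by positivity),
      ENNReal.toReal_ofReal (by positivity)] at this

/-- Capacitary estimate obtained by testing with a truncation of `1 - u / c`. -/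
theorem ofReal_pCap_mul_enorm_rpow_le {n : ℕ} {p : ℝ} (hp : 1 ≤ p)
    {z : EuclideanSpace ℝ (Fin n)} {r : ℝ} (hr : 0 < r) {K : Set (EuclideanSpace ℝ (Fin n))}
    (hK : K ⊆ closedBall z r) {u : EuclideanSpace ℝ (Fin n) → ℝ} {L : ℝ≥0}
    (hu : LipschitzWith L u) (hc : HasCompactSupport u) (hu0 : ∀ x ∈ K, u x = 0) (c : ℝ) :
    ENNReal.ofReal (pCap n p K (ball z (2 * r))) * ‖c‖ₑ ^ p ≤
      2 ^ (p - 1) * ((∫⁻ x in ball z (2 * r), ‖fderiv ℝ u x‖ₑ ^ p) +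
        ENNReal.ofReal (2 / r) ^ p * ∫⁻ x in ball z (2 * r), ‖c - u x‖ₑ ^ p) := by
  have hp0 : 0 < p := by linarith
  rcases eq_or_ne c 0 with rfl | hc0
  · simp [hp0]
  obtain ⟨M, hM⟩ := hc.exists_bound_of_continuous hu.continuous
  have hM0 : 0 ≤ M := (norm_nonneg _).trans (hM z)
  set ψ : EuclideanSpace ℝ (Fin n) → ℝ := fun x => ballCutoff z r x * (c - u x) with hψ
  have hw : LipschitzWith L fun x => c - u x := by
    refine LipschitzWith.of_dist_le_mul fun x y => ?_
    rw [dist_sub_left]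
    exact hu.dist_le_mul x y
  have hψL : LipschitzWith _ ψ := (lipschitzWith_ballCutoff z r).mul_of_bounded hw
    (A := 1) (B := ‖c‖₊ + M.toNNReal) (fun x => by simpa using abs_ballCutoff_le_one) fun x => by
      push_cast
      rw [Real.coe_toNNReal _ hM0]
      exact (abs_sub _ _).trans (add_le_add le_rfl (hM x))
  have hψs : tsupport ψ ⊆ closedBall z (3 / 2 * r) := tsupport_mul_ballCutoff_subset hr _
  have hφψ : ∀ x, fderiv ℝ (fun x => c⁻¹ * ψ x) x = c⁻¹ • fderiv ℝ ψ x := fun x =>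
    congrFun (fderiv_const_smul_field c⁻¹ (f := ψ)) x
  have hts : tsupport (fun x => c⁻¹ * ψ x) ⊆ closedBall z (3 / 2 * r) :=
    (closure_mono (Function.support_mul_subset_right _ _)).trans hψs
  have hcap : pCap n p K (ball z (2 * r)) ≤
      ∫ x in ball z (2 * r), ‖fderiv ℝ (fun x => c⁻¹ * ψ x) x‖ ^ p := by
    refine pCap_le_integral ((lipschitzWith_smul c⁻¹).comp hψL)
      ((isCompact_closedBall z _).of_isClosed_subset (isClosed_tsupport _) hts)
      (hts.trans (closedBall_subset_ball (by linarith))) fun x hx => ?_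
    simp [hψ, hu0 x hx, ballCutoff_eq_one hr (hK hx), hc0]
  rw [integral_norm_rpow_eq_toReal_lintegral
    (measurable_fderiv ℝ _).aestronglyMeasurable hp0.le] at hcap
  have hψd : ∀ᵐ x, ‖fderiv ℝ ψ x‖ₑ ≤ ‖fderiv ℝ u x‖ₑ + ENNReal.ofReal (2 / r) * ‖c - u x‖ₑ := by
    filter_upwards [hu.ae_differentiableAt, (lipschitzWith_ballCutoff z r).ae_differentiableAt]
      with x hxu hxη
    have hd := hxη.hasFDerivAt.mul (hxu.hasFDerivAt.const_sub c)
    rw [show fderiv ℝ ψ x = _ from hd.fderiv]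
    refine (enorm_add_le (E := EuclideanSpace ℝ (Fin n) →L[ℝ] ℝ) _ _).trans ?_
    rw [smul_neg, enorm_neg, enorm_smul, enorm_smul, mul_comm ‖c - u x‖ₑ]
    gcongr
    · refine mul_le_of_le_one_left' ?_
      rw [← enorm_one (G := ℝ), enorm_le_iff_norm_le, norm_one]
      exact abs_ballCutoff_le_one
    · rw [← ofReal_norm]
      refine ENNReal.ofReal_le_ofReal ?_
      simpa [abs_of_pos hr] using norm_fderiv_le_of_lipschitz ℝ (lipschitzWith_ballCutoff z r)
  have hmG : Measurable fun x => ‖fderiv ℝ u x‖ₑ ^ p :=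
    (measurable_fderiv ℝ u).enorm.pow_const p
  calc _ ≤ (∫⁻ x in ball z (2 * r), ‖fderiv ℝ (fun x => c⁻¹ * ψ x) x‖ₑ ^ p) * ‖c‖ₑ ^ p := by
        gcongr
        exact (ENNReal.ofReal_le_ofReal hcap).trans ENNReal.ofReal_toReal_le
    _ = ∫⁻ x in ball z (2 * r), ‖fderiv ℝ ψ x‖ₑ ^ p := by
        rw [← lintegral_mul_const _ ((measurable_fderiv ℝ _).enorm.pow_const p)]
        refine lintegral_congr fun x => ?_
        rw [← ENNReal.mul_rpow_of_nonneg _ _ hp0.le, hφψ, enorm_smul, mul_right_comm, ← enorm_mul,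
          inv_mul_cancel₀ hc0, enorm_one, one_mul]
    _ ≤ ∫⁻ x in ball z (2 * r), 2 ^ (p - 1) * (‖fderiv ℝ u x‖ₑ ^ p +
          ENNReal.ofReal (2 / r) ^ p * ‖c - u x‖ₑ ^ p) := by
        refine lintegral_mono_ae (ae_restrict_of_ae ?_)
        filter_upwards [hψd] with x hx
        refine (ENNReal.rpow_le_rpow hx hp0.le).trans ?_
        rw [← ENNReal.mul_rpow_of_nonneg _ _ hp0.le]
        exact ENNReal.rpow_add_le_mul_rpow_add_rpow _ _ hp
    _ = _ := by
        have hmu : Measurable fun x => ‖c - u x‖ₑ ^ p := by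
          have := hu.continuous
          exact (by fun_prop : Continuous fun x => c - u x).measurable.enorm.pow_const p
        rw [lintegral_const_mul' _ _ (by finiteness), lintegral_add_left hmG,
          lintegral_const_mul _ hmu]

/-- The Maz'ya inequality on balls centred at the boundary of a uniformly fat set. -/
theorem UniformlyFat.exists_lintegral_ball_enorm_rpow_le {n : ℕ}
    [Nontrivial (EuclideanSpace ℝ (Fin n))] {p c₀ r₀ : ℝ} {F : Set (EuclideanSpace ℝ (Fin n))}
    (hF : UniformlyFat n p c₀ r₀ F) (hp : 1 ≤ p) (hc₀ : 0 < c₀) :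
    ∃ C : ℝ≥0∞, C ≠ ⊤ ∧ ∀ z ∈ frontier F, ∀ r : ℝ, 0 < r → r ≤ r₀ →
      ∀ (u : EuclideanSpace ℝ (Fin n) → ℝ) (L : ℝ≥0), LipschitzWith L u → HasCompactSupport u →
        (∀ x ∈ F, u x = 0) →
        ∫⁻ x in ball z (2 * r), ‖u x‖ₑ ^ p ≤
          C * ENNReal.ofReal r ^ p * ∫⁻ x in ball z (6 * r), ‖fderiv ℝ u x‖ₑ ^ p := by
  have hp0 : 0 < p := by linarith
  set d := Module.finrank ℝ (EuclideanSpace ℝ (Fin n))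
  refine ⟨(ENNReal.ofReal c₀)⁻¹ * (4 ^ p * 2 ^ (p - 1) * (2 ^ d + 8 ^ p * 4 ^ d)), ?_, ?_⟩
  · have : (ENNReal.ofReal c₀)⁻¹ ≠ ⊤ := by simpa using hc₀
    finiteness
  intro z hz r hr hr₀ u L hu hc hu0
  set V := volume (ball z r) with hV
  have hV0 : V ≠ 0 := (measure_ball_pos _ _ hr).ne'
  have hVt : V ≠ ⊤ := measure_ball_lt_top.ne
  have hball : ∀ (a : ℕ) (x : EuclideanSpace ℝ (Fin n)),
      volume (ball x (a * r)) = (a : ℝ≥0∞) ^ d * V := fun a x => by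
    rw [hV, Measure.addHaar_ball _ _ (by positivity), Measure.addHaar_ball _ _ hr.le, ← mul_assoc,
      mul_pow, ENNReal.ofReal_mul (by positivity), ENNReal.ofReal_pow (by positivity) d,
      ENNReal.ofReal_natCast]
  set I := ∫⁻ x in ball z (6 * r), ‖fderiv ℝ u x‖ₑ ^ p
  set P := pCap n p (F ∩ closedBall z r) (ball z (2 * r))
  have hP : ENNReal.ofReal c₀ * V ≤ ENNReal.ofReal (4 * r) ^ p * ENNReal.ofReal P := by
    have h1 := (mul_le_mul_of_nonneg_left (volume_div_le_pCap_closedBall hp z hr) hc₀.le).trans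
      (hF z hz r hr hr₀)
    rw [mul_div_assoc', div_le_iff₀' (by positivity)] at h1
    have h2 := ENNReal.ofReal_le_ofReal h1
    rwa [ENNReal.ofReal_mul hc₀.le, ENNReal.ofReal_mul (by positivity), ofReal_measureReal,
      ← ENNReal.ofReal_rpow_of_pos (by positivity)] at h2
  have huc := hu.continuous
  have hI : ENNReal.ofReal P * ∫⁻ y in ball z (2 * r), ‖u y‖ₑ ^ p ≤
      2 ^ (p - 1) * ((2 ^ d + 8 ^ p * 4 ^ d) * V * I) := by
    have hI2 : ∫⁻ x in ball z (2 * r), ‖fderiv ℝ u x‖ₑ ^ p ≤ I :=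
      lintegral_mono_set (ball_subset_ball (by linarith))
    have hJ := hu.lintegral_lintegral_enorm_sub_rpow_le volume hp z (2 * r)
    rw [show 2 * (2 * r) = (4 : ℕ) * r by push_cast; ring, hball,
      show 3 * (2 * r) = 6 * r by ring] at hJ
    have h8 : ENNReal.ofReal (2 / r) ^ p * ENNReal.ofReal ((4 : ℕ) * r) ^ p = 8 ^ p := by
      rw [← ENNReal.mul_rpow_of_nonneg _ _ hp0.le, ← ENNReal.ofReal_mul (by positivity),
        show 2 / r * ((4 : ℕ) * r) = (8 : ℕ) by field_simp; norm_num, ENNReal.ofReal_natCast]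
      norm_num
    rw [← lintegral_const_mul' _ _ ENNReal.ofReal_ne_top]
    calc _ ≤ ∫⁻ y in ball z (2 * r), 2 ^ (p - 1) *
          (I + ENNReal.ofReal (2 / r) ^ p * ∫⁻ x in ball z (2 * r), ‖u y - u x‖ₑ ^ p) := by
          refine lintegral_mono fun y => ?_
          refine (ofReal_pCap_mul_enorm_rpow_le hp hr Set.inter_subset_right hu hc
            (fun x hx => hu0 x hx.1) (u y)).trans ?_
          gcongr
      _ = 2 ^ (p - 1) * (I * volume (ball z (2 * r)) + ENNReal.ofReal (2 / r) ^ p *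
          ∫⁻ y in ball z (2 * r), ∫⁻ x in ball z (2 * r), ‖u y - u x‖ₑ ^ p) := by
          rw [lintegral_const_mul' _ _ (by finiteness), lintegral_add_left measurable_const,
            setLIntegral_const, lintegral_const_mul' _ _ (by finiteness)]
      _ ≤ 2 ^ (p - 1) * (I * ((2 : ℕ) ^ d * V) + ENNReal.ofReal (2 / r) ^ p *
          ((4 : ℕ) ^ d * V * (ENNReal.ofReal ((4 : ℕ) * r) ^ p * I))) := by
          rw [← hball 2 z]
          gcongr
          simp
      _ = 2 ^ (p - 1) * (I * ((2 : ℕ) ^ d * V) + (ENNReal.ofReal (2 / r) ^ p *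
          ENNReal.ofReal ((4 : ℕ) * r) ^ p) * ((4 : ℕ) ^ d * V * I)) := by ring
      _ = _ := by rw [h8]; push_cast; ring
  have h4 : ENNReal.ofReal (4 * r) ^ p = 4 ^ p * ENNReal.ofReal r ^ p := by
    rw [ENNReal.ofReal_mul (by norm_num), ENNReal.mul_rpow_of_nonneg _ _ hp0.le]
    norm_num
  have hmain : V * (ENNReal.ofReal c₀ * ∫⁻ y in ball z (2 * r), ‖u y‖ₑ ^ p) ≤
      V * (4 ^ p * 2 ^ (p - 1) * (2 ^ d + 8 ^ p * 4 ^ d) * ENNReal.ofReal r ^ p * I) := by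
    calc _ = ENNReal.ofReal c₀ * V * ∫⁻ y in ball z (2 * r), ‖u y‖ₑ ^ p := by ring
      _ ≤ ENNReal.ofReal (4 * r) ^ p * ENNReal.ofReal P *
          ∫⁻ y in ball z (2 * r), ‖u y‖ₑ ^ p := by gcongr
      _ ≤ ENNReal.ofReal (4 * r) ^ p * (2 ^ (p - 1) * ((2 ^ d + 8 ^ p * 4 ^ d) * V * I)) := by
          rw [mul_assoc]; gcongr
      _ = _ := by rw [h4]; ring
  rw [ENNReal.mul_le_mul_iff_right hV0 hVt, mul_comm, ← ENNReal.le_div_iff_mul_le (by simp [hc₀])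
    (by simp)] at hmain
  refine hmain.trans_eq ?_
  rw [ENNReal.div_eq_inv_mul]
  ring

/-- The Maz'ya inequality on neighbourhoods of the boundary of a uniformly fat set. -/
theorem UniformlyFat.exists_setLIntegral_infDist_lt_le {n : ℕ}
    [Nontrivial (EuclideanSpace ℝ (Fin n))] {p c₀ r₀ : ℝ} {F : Set (EuclideanSpace ℝ (Fin n))}
    (hF : UniformlyFat n p c₀ r₀ F) (hp : 1 ≤ p) (hc₀ : 0 < c₀) (hne : (frontier F).Nonempty) :
    ∃ C : ℝ≥0∞, C ≠ ⊤ ∧ ∀ t : ℝ, 0 < t → t ≤ r₀ →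
      ∀ (u : EuclideanSpace ℝ (Fin n) → ℝ) (L : ℝ≥0), LipschitzWith L u → HasCompactSupport u →
        (∀ x ∈ F, u x = 0) →
        ∫⁻ x in {x | infDist x (frontier F) < t / 2}, ‖u x‖ₑ ^ p ≤
          C * ENNReal.ofReal t ^ p *
            ∫⁻ x in {x | infDist x (frontier F) < 8 * t}, ‖fderiv ℝ u x‖ₑ ^ p := by
  obtain ⟨C, hC, H⟩ := hF.exists_lintegral_ball_enorm_rpow_le hp hc₀
  set d := Module.finrank ℝ (EuclideanSpace ℝ (Fin n))
  refine ⟨C * 14 ^ d, by finiteness, fun t ht htr u L hu hc hu0 => ?_⟩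
  set δ : EuclideanSpace ℝ (Fin n) → ℝ := fun x => infDist x (frontier F) with hδ
  have hδl : ∀ x y, δ x ≤ δ y + dist x y := fun x y => infDist_le_infDist_add_dist
  have hδm : ∀ s, MeasurableSet {x | δ x < s} := fun s =>
    measurableSet_lt (continuous_infDist_pt _).measurable measurable_const
  set V := volume (ball (0 : EuclideanSpace ℝ (Fin n)) (t / 2)) with hV
  have hV0 : V ≠ 0 := (measure_ball_pos _ _ (by positivity)).ne'
  have hVt : V ≠ ⊤ := measure_ball_lt_top.ne
  have hV2 : ∀ x : EuclideanSpace ℝ (Fin n), volume (ball x (t / 2)) = V := fun x => by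
    rw [hV, Measure.addHaar_ball_center]
  have hV14 : ∀ x : EuclideanSpace ℝ (Fin n), volume (ball x (7 * t)) = 14 ^ d * V := fun x => by
    rw [hV, Measure.addHaar_ball _ x (by positivity),
      Measure.addHaar_ball _ 0 (by positivity : 0 ≤ t / 2), ← mul_assoc,
      show 7 * t = (14 : ℕ) * (t / 2) by push_cast; ring, mul_pow,
      ENNReal.ofReal_mul (by positivity), ENNReal.ofReal_pow (by positivity) d,
      ENNReal.ofReal_natCast]
    norm_num
  have hu' : Measurable fun x => ‖u x‖ₑ ^ p := hu.continuous.measurable.enorm.pow_const p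
  have hG : Measurable fun x => ‖fderiv ℝ u x‖ₑ ^ p :=
    (measurable_fderiv ℝ u).enorm.pow_const p
  have hswap : ∀ (s : ℝ) (S : Set (EuclideanSpace ℝ (Fin n))) (f : EuclideanSpace ℝ (Fin n) → ℝ≥0∞),
      Measurable f → ∫⁻ x in S, ∫⁻ y in ball x s, f y =
        ∫⁻ y, f y * volume.restrict S (ball y s) := fun s S f hf => by
    have hm : MeasurableSet {w : EuclideanSpace ℝ (Fin n) × EuclideanSpace ℝ (Fin n) |
        dist w.2 w.1 < s} := measurableSet_lt (by fun_prop) (by fun_prop)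
    calc _ = ∫⁻ x in S, ∫⁻ y, {w : EuclideanSpace ℝ (Fin n) × EuclideanSpace ℝ (Fin n) |
        dist w.2 w.1 < s}.indicator (fun w => f w.2) (x, y) := by
          refine lintegral_congr fun x => ?_
          rw [← lintegral_indicator measurableSet_ball]
          rfl
      _ = ∫⁻ y, ∫⁻ x in S, {w : EuclideanSpace ℝ (Fin n) × EuclideanSpace ℝ (Fin n) |
        dist w.2 w.1 < s}.indicator (fun w => f w.2) (x, y) :=
          lintegral_lintegral_swap ((hf.comp measurable_snd).indicator hm).aemeasurable
      _ = _ := by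
          refine lintegral_congr fun y => ?_
          rw [← setLIntegral_const, ← lintegral_indicator measurableSet_ball]
          refine lintegral_congr fun x => ?_
          simp only [Set.indicator, Set.mem_ofPred_eq, mem_ball, dist_comm]
  have hlocal : ∀ x ∈ {x | δ x < t}, ∫⁻ y in ball x t, ‖u y‖ₑ ^ p ≤
      C * ENNReal.ofReal t ^ p * ∫⁻ y in ball x (7 * t), ‖fderiv ℝ u y‖ₑ ^ p := fun x hx => by
    obtain ⟨z, hz, hxz⟩ := (infDist_lt_iff hne).1 hx
    refine (lintegral_mono_set (ball_subset_ball' (by linarith))).trans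
      ((H z hz t ht htr u L hu hc hu0).trans ?_)
    gcongr
    exact ball_subset_ball' (by rw [dist_comm]; linarith)
  have key : ∫⁻ y, ‖u y‖ₑ ^ p * volume.restrict {x | δ x < t} (ball y t) ≤
      C * ENNReal.ofReal t ^ p *
        ∫⁻ y, ‖fderiv ℝ u y‖ₑ ^ p * volume.restrict {x | δ x < t} (ball y (7 * t)) := by
    rw [← hswap _ _ _ hu', ← hswap _ _ _ hG, ← lintegral_const_mul' _ _ (by finiteness)]
    exact setLIntegral_mono' (hδm t) hlocal
  have hlow : (∫⁻ x in {x | δ x < t / 2}, ‖u x‖ₑ ^ p) * V ≤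
      ∫⁻ y, ‖u y‖ₑ ^ p * volume.restrict {x | δ x < t} (ball y t) := by
    rw [← lintegral_mul_const' _ _ hVt]
    refine (setLIntegral_mono' (hδm _) fun y hy => ?_).trans (setLIntegral_le_lintegral _ _)
    gcongr
    rw [Measure.restrict_apply measurableSet_ball, ← hV2 y]
    refine measure_mono fun x hx => ⟨ball_subset_ball (by linarith) hx, ?_⟩
    have := hδl x y
    rw [mem_ball] at hx
    simp only [Set.mem_ofPred_eq] at hy ⊢
    linarith
  have hup : ∫⁻ y, ‖fderiv ℝ u y‖ₑ ^ p * volume.restrict {x | δ x < t} (ball y (7 * t)) ≤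
      (∫⁻ x in {x | δ x < 8 * t}, ‖fderiv ℝ u x‖ₑ ^ p) * (14 ^ d * V) := by
    rw [← lintegral_mul_const' _ _ (by finiteness), ← lintegral_indicator (hδm _)]
    refine lintegral_mono fun y => ?_
    by_cases hy : δ y < 8 * t
    · rw [Set.indicator_of_mem (by exact hy), ← hV14 y]
      exact mul_le_mul' le_rfl (Measure.restrict_apply_le _ _)
    · have : ball y (7 * t) ∩ {x | δ x < t} = ∅ := by
        refine Set.eq_empty_of_forall_notMem fun x ⟨hx, hx'⟩ => hy ?_
        have := hδl y x
        rw [mem_ball'] at hx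
        simp only [Set.mem_ofPred_eq] at hx'
        linarith
      rw [Measure.restrict_apply measurableSet_ball, this]
      simp
  rw [← ENNReal.mul_le_mul_iff_left hV0 hVt]
  refine (hlow.trans (key.trans (mul_le_mul_right hup _))).trans_eq ?_
  ring

/-- Exchange of the order of integration over a subgraph-type region. -/
theorem lintegral_mul_setLIntegral_lt {α : Type*} [MeasurableSpace α] {μ : Measure α} [SFinite μ]
    {δ : α → ℝ} (hδ : Measurable δ) {f : α → ℝ≥0∞} (hf : Measurable f) {w : ℝ → ℝ≥0∞}
    (hw : Measurable w) {g : ℝ → ℝ} (hg : Measurable g) (T : Set ℝ) :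
    ∫⁻ t in T, w t * ∫⁻ x in {x | δ x < g t}, f x ∂μ =
      ∫⁻ x, f x * (∫⁻ t in T, {t | δ x < g t}.indicator w t) ∂μ := by
  have hm : MeasurableSet {q : ℝ × α | δ q.2 < g q.1} :=
    measurableSet_lt (hδ.comp measurable_snd) (hg.comp measurable_fst)
  have hF : Measurable ({q : ℝ × α | δ q.2 < g q.1}.indicator fun q => w q.1 * f q.2) :=
    ((hw.comp measurable_fst).mul (hf.comp measurable_snd)).indicator hm
  calc _ = ∫⁻ t in T, (∫⁻ x, {q : ℝ × α | δ q.2 < g q.1}.indicator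
        (fun q => w q.1 * f q.2) (t, x) ∂μ) := by
        refine lintegral_congr fun t => ?_
        rw [← lintegral_indicator (measurableSet_lt hδ measurable_const),
          ← lintegral_const_mul _ (hf.indicator (measurableSet_lt hδ measurable_const))]
        refine lintegral_congr fun x => ?_
        simp only [Set.indicator, Set.mem_ofPred_eq]
        split_ifs <;> simp
    _ = ∫⁻ x, (∫⁻ t in T, {q : ℝ × α | δ q.2 < g q.1}.indicator
        (fun q => w q.1 * f q.2) (t, x)) ∂μ := lintegral_lintegral_swap hF.aemeasurable
    _ = _ := by
        refine lintegral_congr fun x => ?_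
        rw [← lintegral_const_mul _ (hw.indicator (measurableSet_lt measurable_const hg))]
        refine lintegral_congr fun t => ?_
        simp only [Set.indicator, Set.mem_ofPred_eq]
        split_ifs <;> simp [mul_comm]

theorem setLIntegral_Ioi_rpow {s a : ℝ} (hs : 0 < s) (ha : 0 < a) :
    ∫⁻ t in Set.Ioi a, ENNReal.ofReal (t ^ (-s - 1)) = ENNReal.ofReal (a ^ (-s) / s) := by
  rw [← ofReal_integral_eq_lintegral_ofReal (integrableOn_Ioi_rpow_of_lt (by linarith) ha),
    integral_Ioi_rpow_of_lt (by linarith) ha]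
  · congr 1
    rw [show -s - 1 + 1 = -s by ring]
    field_simp
  · filter_upwards [ae_restrict_mem measurableSet_Ioi] with t ht
    exact Real.rpow_nonneg (ha.le.trans ht.le) _

theorem ofReal_rpow_le_setLIntegral_Ioc_rpow {q a : ℝ} (hq : 0 ≤ q) (ha : 0 < a) :
    ENNReal.ofReal (2⁻¹ * 4 ^ (-q) * a ^ (-q)) ≤
      ∫⁻ t in Set.Ioc (2 * a) (4 * a), ENNReal.ofReal (t ^ (-q - 1)) := by
  calc _ = ENNReal.ofReal ((4 * a) ^ (-q - 1)) * volume (Set.Ioc (2 * a) (4 * a)) := by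
        rw [Real.volume_Ioc, ← ENNReal.ofReal_mul (by positivity), Real.rpow_sub_one (by positivity),
          Real.mul_rpow (by norm_num) ha.le]
        congr 1
        field_simp
        ring
    _ = ∫⁻ _ in Set.Ioc (2 * a) (4 * a), ENNReal.ofReal ((4 * a) ^ (-q - 1)) := by
        rw [setLIntegral_const]
    _ ≤ _ := by
        refine setLIntegral_mono' measurableSet_Ioc fun t ht => ENNReal.ofReal_le_ofReal ?_
        exact Real.rpow_le_rpow_of_nonpos (by linarith [ht.1]) ht.2 (by linarith)

/-- Weighted Hardy inequality near the boundary of a uniformly fat set, for weights with a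
slightly more negative exponent; the constant blows up only like `1 / s`. -/
theorem UniformlyFat.exists_weighted_hardy {n : ℕ}
    [Nontrivial (EuclideanSpace ℝ (Fin n))] {p c₀ r₀ : ℝ} {F : Set (EuclideanSpace ℝ (Fin n))}
    (hF : UniformlyFat n p c₀ r₀ F) (hFc : IsClosed F) (hp : 1 ≤ p) (hc₀ : 0 < c₀)
    (hne : (frontier F).Nonempty) :
    ∃ C : ℝ≥0∞, C ≠ ⊤ ∧ ∀ s : ℝ, 0 < s → s ≤ 1 →
      ∀ (u : EuclideanSpace ℝ (Fin n) → ℝ) (L : ℝ≥0), LipschitzWith L u → HasCompactSupport u →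
        tsupport u ⊆ Fᶜ →
        ∫⁻ x in Fᶜ ∩ {x | infDist x (frontier F) < r₀ / 4},
            ‖u x‖ₑ ^ p * ENNReal.ofReal (infDist x (frontier F) ^ (-(p + s))) ≤
          C * ENNReal.ofReal (1 / s) * ∫⁻ x in Fᶜ,
            ‖fderiv ℝ u x‖ₑ ^ p * ENNReal.ofReal (infDist x (frontier F) ^ (-s)) := by
  have hp0 : 0 < p := by linarith
  obtain ⟨C, hC, H⟩ := hF.exists_setLIntegral_infDist_lt_le hp hc₀ hne
  set κ : ℝ := 2⁻¹ * 4 ^ (-(p + 1)) with hκ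
  have hκ0 : 0 < κ := by positivity
  refine ⟨(ENNReal.ofReal κ)⁻¹ * C * 8, ?_, fun s hs hs1 u L hu hc hts => ?_⟩
  · have : (ENNReal.ofReal κ)⁻¹ ≠ ⊤ := by simpa using hκ0
    finiteness
  have hu0 : ∀ x ∈ F, u x = 0 := fun x hx =>
    image_eq_zero_of_notMem_tsupport fun h => hts h hx
  have hG0 : ∀ x ∈ F, ‖fderiv ℝ u x‖ₑ ^ p = 0 := fun x hx => by
    have h : fderiv ℝ u x = 0 := by
      by_contra h
      exact hts (support_fderiv_subset ℝ h) hx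
    rw [← ofReal_norm, h, norm_zero, ENNReal.ofReal_zero, ENNReal.zero_rpow_of_pos hp0]
  set δ : EuclideanSpace ℝ (Fin n) → ℝ := fun x => infDist x (frontier F)
  have hδpos : ∀ x ∈ Fᶜ, 0 < δ x := fun x hx =>
    (isClosed_frontier.notMem_iff_infDist_pos hne).1 fun h => hx (hFc.frontier_subset h)
  have hδm : Measurable δ := (continuous_infDist_pt _).measurable
  have hu' : Measurable fun x => ‖u x‖ₑ ^ p := hu.continuous.measurable.enorm.pow_const p
  have hG : Measurable fun x => ‖fderiv ℝ u x‖ₑ ^ p :=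
    (measurable_fderiv ℝ u).enorm.pow_const p
  have hwm : ∀ q : ℝ, Measurable fun t : ℝ => ENNReal.ofReal (t ^ q) := fun q => by fun_prop
  have hmid : ∫⁻ t in Set.Ioc 0 r₀, ENNReal.ofReal (t ^ (-(p + s) - 1)) *
        (∫⁻ x in {x | δ x < t / 2}, ‖u x‖ₑ ^ p) ≤
      C * ∫⁻ t in Set.Ioc 0 r₀, ENNReal.ofReal (t ^ (-s - 1)) *
        (∫⁻ x in {x | δ x < 8 * t}, ‖fderiv ℝ u x‖ₑ ^ p) := by
    rw [← lintegral_const_mul' _ _ hC]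
    refine setLIntegral_mono' measurableSet_Ioc fun t ht => ?_
    have hpow : ENNReal.ofReal (t ^ (-(p + s) - 1)) * ENNReal.ofReal t ^ p =
        ENNReal.ofReal (t ^ (-s - 1)) := by
      rw [ENNReal.ofReal_rpow_of_pos ht.1, ← ENNReal.ofReal_mul (Real.rpow_nonneg ht.1.le _),
        ← Real.rpow_add ht.1]
      ring_nf
    calc _ ≤ ENNReal.ofReal (t ^ (-(p + s) - 1)) * (C * ENNReal.ofReal t ^ p *
          ∫⁻ x in {x | δ x < 8 * t}, ‖fderiv ℝ u x‖ₑ ^ p) :=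
          mul_le_mul' le_rfl (H t ht.1 ht.2 u L hu hc hu0)
      _ = C * ((ENNReal.ofReal (t ^ (-(p + s) - 1)) * ENNReal.ofReal t ^ p) *
          ∫⁻ x in {x | δ x < 8 * t}, ‖fderiv ℝ u x‖ₑ ^ p) := by ring
      _ = _ := by rw [hpow]
  rw [lintegral_mul_setLIntegral_lt hδm hu' (hwm _) (by fun_prop),
    lintegral_mul_setLIntegral_lt hδm hG (hwm _) (by fun_prop)] at hmid
  have hS : MeasurableSet (Fᶜ ∩ {x | δ x < r₀ / 4}) :=
    hFc.measurableSet.compl.inter (measurableSet_lt hδm measurable_const)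
  have hlow : ENNReal.ofReal κ * ∫⁻ x in Fᶜ ∩ {x | δ x < r₀ / 4},
        ‖u x‖ₑ ^ p * ENNReal.ofReal (δ x ^ (-(p + s))) ≤
      ∫⁻ x, ‖u x‖ₑ ^ p * (∫⁻ t in Set.Ioc 0 r₀,
        {t | δ x < t / 2}.indicator (fun t => ENNReal.ofReal (t ^ (-(p + s) - 1))) t) := by
    rw [← lintegral_const_mul' _ _ ENNReal.ofReal_ne_top]
    refine (setLIntegral_mono' hS fun x hx => ?_).trans (setLIntegral_le_lintegral _ _)
    have hx0 := hδpos x hx.1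
    have hx1 : δ x < r₀ / 4 := hx.2
    rw [mul_left_comm]
    refine mul_le_mul' le_rfl ?_
    rw [← ENNReal.ofReal_mul hκ0.le]
    calc _ ≤ ENNReal.ofReal (2⁻¹ * 4 ^ (-(p + s)) * δ x ^ (-(p + s))) := by
          refine ENNReal.ofReal_le_ofReal ?_
          rw [hκ]
          gcongr
          norm_num
      _ ≤ _ := ofReal_rpow_le_setLIntegral_Ioc_rpow (by linarith) hx0
      _ ≤ _ := by
          rw [← lintegral_indicator measurableSet_Ioc, ← lintegral_indicator measurableSet_Ioc]
          refine lintegral_mono fun t => ?_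
          by_cases ht : t ∈ Set.Ioc (2 * δ x) (4 * δ x)
          · have h1 : t ∈ Set.Ioc 0 r₀ := ⟨by linarith [ht.1], by linarith [ht.2]⟩
            have h2 : δ x < t / 2 := by linarith [ht.1]
            rw [Set.indicator_of_mem ht, Set.indicator_of_mem h1, Set.indicator_of_mem (by exact h2)]
          · rw [Set.indicator_of_notMem ht]
            exact zero_le
  have hup : ∫⁻ x, ‖fderiv ℝ u x‖ₑ ^ p * (∫⁻ t in Set.Ioc 0 r₀,
        {t | δ x < 8 * t}.indicator (fun t => ENNReal.ofReal (t ^ (-s - 1))) t) ≤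
      8 * ENNReal.ofReal (1 / s) * ∫⁻ x in Fᶜ,
        ‖fderiv ℝ u x‖ₑ ^ p * ENNReal.ofReal (δ x ^ (-s)) := by
    rw [← lintegral_const_mul' _ _ (by finiteness),
      ← lintegral_indicator hFc.measurableSet.compl]
    refine lintegral_mono fun x => ?_
    by_cases hx : x ∈ F
    · rw [hG0 x hx, zero_mul]
      exact zero_le
    have hx0 := hδpos x hx
    rw [Set.indicator_of_mem (by exact hx), mul_left_comm]
    refine mul_le_mul' le_rfl ?_
    calc _ ≤ ∫⁻ t in Set.Ioi (δ x / 8), ENNReal.ofReal (t ^ (-s - 1)) := by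
          rw [← lintegral_indicator measurableSet_Ioi]
          refine (setLIntegral_le_lintegral _ _).trans (lintegral_mono fun t => ?_)
          refine Set.indicator_le_indicator_of_subset (fun t ht => ?_) (fun _ => zero_le) t
          have : δ x < 8 * t := ht
          exact (by linarith : δ x / 8 < t)
      _ = ENNReal.ofReal ((δ x / 8) ^ (-s) / s) := setLIntegral_Ioi_rpow hs (by positivity)
      _ ≤ ENNReal.ofReal (8 * (1 / s) * δ x ^ (-s)) := by
          refine ENNReal.ofReal_le_ofReal ?_
          rw [Real.div_rpow hx0.le (by norm_num), Real.rpow_neg (by norm_num : (0 : ℝ) ≤ 8),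
            div_inv_eq_mul]
          have : (8 : ℝ) ^ s ≤ 8 := by
            simpa using Real.rpow_le_rpow_of_exponent_le (by norm_num : (1 : ℝ) ≤ 8) hs1
          calc _ ≤ δ x ^ (-s) * 8 / s := by gcongr
            _ = _ := by ring
      _ = _ := by
          rw [ENNReal.ofReal_mul (by positivity), ENNReal.ofReal_mul (by norm_num)]
          norm_num
  have hfin := hlow.trans (hmid.trans (mul_le_mul' le_rfl hup))
  rw [mul_comm, ← ENNReal.le_div_iff_mul_le (by simp [hκ0]) (by simp)] at hfin
  refine hfin.trans_eq ?_
  rw [ENNReal.div_eq_inv_mul]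
  ring

theorem Real.lipschitzOnWith_rpow_Ici {a m : ℝ} (ha0 : 0 ≤ a) (ha1 : a ≤ 1) (hm : 0 < m) :
    LipschitzOnWith (a * m ^ (a - 1)).toNNReal (fun t : ℝ => t ^ a) (Set.Ici m) := by
  refine (convex_Ici m).lipschitzOnWith_of_nnnorm_hasDerivWithin_le
    (f' := fun t => a * t ^ (a - 1)) (fun t ht => ?_) fun t ht => ?_
  · exact (Real.hasDerivAt_rpow_const (Or.inl (hm.trans_le ht).ne')).hasDerivWithinAt
  · have ht0 : 0 < t := hm.trans_le ht
    rw [← NNReal.coe_le_coe, coe_nnnorm, Real.norm_of_nonneg (by positivity),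
      Real.coe_toNNReal _ (by positivity)]
    exact mul_le_mul_of_nonneg_left (Real.rpow_le_rpow_of_nonpos hm ht (by linarith)) ha0

/-- Multiplying a compactly supported Lipschitz function by a power of a Lipschitz function that is
bounded below on the support gives a Lipschitz function. -/
theorem LipschitzWith.exists_lipschitzWith_mul_rpow {α : Type*} [PseudoMetricSpace α] {f δ : α → ℝ}
    {K : ℝ≥0} (hf : LipschitzWith K f) (hc : HasCompactSupport f) (hδ : LipschitzWith 1 δ)
    (hpos : ∀ x ∈ tsupport f, 0 < δ x) {a : ℝ} (ha0 : 0 ≤ a) (ha1 : a ≤ 1) :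
    ∃ L, LipschitzWith L fun x => f x * δ x ^ a := by
  obtain ⟨m, hm, hmδ⟩ := hc.exists_forall_le' hδ.continuous.continuousOn hpos
  obtain ⟨B, hB⟩ := hc.exists_bound_of_continuousOn hδ.continuous.continuousOn
  obtain ⟨A, hA⟩ := hc.exists_bound_of_continuous hf.continuous
  set g : α → ℝ := fun x => max m (min B (δ x)) with hg
  have hgL : LipschitzWith 1 g := (hδ.const_min B).const_max m
  have hgm : ∀ x, g x ∈ Set.Ici m := fun x => Set.mem_Ici.2 (le_max_left _ _)
  have hga : LipschitzWith _ ((fun t : ℝ => t ^ a) ∘ g) := lipschitzOnWith_univ.1 <|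
    (Real.lipschitzOnWith_rpow_Ici ha0 ha1 hm).comp hgL.lipschitzOnWith fun x _ => hgm x
  have hgb : ∀ x, |(g x) ^ a| ≤ ((max m B) ^ a).toNNReal := fun x => by
    have h0 : 0 ≤ g x := hm.le.trans (hgm x)
    have h1 : g x ≤ max m B := max_le_max le_rfl (min_le_left _ _)
    rw [abs_of_nonneg (by positivity), Real.coe_toNNReal _ (Real.rpow_nonneg (h0.trans h1) _)]
    gcongr
  have hfg : (fun x => f x * δ x ^ a) = fun x => f x * ((fun t : ℝ => t ^ a) ∘ g) x := by
    funext x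
    by_cases hx : x ∈ tsupport f
    · have h2 : g x = δ x := by
        rw [hg]
        simp only
        rw [min_eq_right ((le_abs_self _).trans (hB x hx)), max_eq_right (hmδ x hx)]
      simp [h2]
    · simp [image_eq_zero_of_notMem_tsupport hx]
  rw [hfg]
  exact ⟨_, hf.mul_of_bounded hga (A := A.toNNReal)
    (fun x => (hA x).trans (Real.le_coe_toNNReal A)) hgb⟩

/-- Gradient estimate for the product of a function with a power of a `1`-Lipschitz function. -/
theorem enorm_fderiv_mul_rpow_le {E : Type*} [NormedAddCommGroup E] [NormedSpace ℝ E]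
    {f δ : E → ℝ} (hδ : LipschitzWith 1 δ) {x : E} (hfx : DifferentiableAt ℝ f x)
    (hδx : DifferentiableAt ℝ δ x) (hx : 0 < δ x) {a : ℝ} (ha : 0 ≤ a) :
    ‖fderiv ℝ (fun x => f x * δ x ^ a) x‖ₑ ≤ ENNReal.ofReal (δ x ^ a) * ‖fderiv ℝ f x‖ₑ +
      ENNReal.ofReal (a * δ x ^ (a - 1)) * ‖f x‖ₑ := by
  have hd := hfx.hasFDerivAt.mul (hδx.hasFDerivAt.rpow_const (p := a) (Or.inl hx.ne'))
  rw [show fderiv ℝ (fun x => f x * δ x ^ a) x = _ from hd.fderiv, ← ofReal_norm, ← ofReal_norm,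
    ← ofReal_norm, ← ENNReal.ofReal_mul (by positivity), ← ENNReal.ofReal_mul (by positivity),
    ← ENNReal.ofReal_add (by positivity) (by positivity)]
  refine ENNReal.ofReal_le_ofReal ?_
  have h1 : ‖fderiv ℝ δ x‖ ≤ 1 := norm_fderiv_le_of_lipschitz ℝ hδ
  refine (norm_add_le _ _).trans ?_
  rw [norm_smul, norm_smul, norm_smul, Real.norm_of_nonneg (by positivity : 0 ≤ a * δ x ^ (a - 1)),
    Real.norm_of_nonneg (by positivity : 0 ≤ δ x ^ a), add_comm, mul_comm ‖f x‖]
  exact add_le_add le_rfl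
    (mul_le_mul_of_nonneg_right (mul_le_of_le_one_right (by positivity) h1) (norm_nonneg _))

theorem ENNReal.mul_rpow_mul_rpow_le {p s : ℝ} (hp : 1 ≤ p) (hs : 0 ≤ s) {d : ℝ} (hd : 0 < d)
    {A B G : ℝ≥0∞} (hG : G ≤ ENNReal.ofReal (d ^ (s / p)) * A +
      ENNReal.ofReal (s / p * d ^ (s / p - 1)) * B) :
    G ^ p * ENNReal.ofReal (d ^ (-s)) ≤
      2 ^ (p - 1) * (A ^ p + ENNReal.ofReal ((s / p) ^ p) * (B ^ p * ENNReal.ofReal (d ^ (-p)))) := by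
  have hp0 : 0 < p := by linarith
  have h1 : ENNReal.ofReal (d ^ (s / p)) ^ p * ENNReal.ofReal (d ^ (-s)) = 1 := by
    rw [ENNReal.ofReal_rpow_of_nonneg (by positivity) hp0.le, ← ENNReal.ofReal_mul (by positivity),
      ← Real.rpow_mul hd.le, ← Real.rpow_add hd, div_mul_cancel₀ _ hp0.ne']
    simp
  have h2 : ENNReal.ofReal (s / p * d ^ (s / p - 1)) ^ p * ENNReal.ofReal (d ^ (-s)) =
      ENNReal.ofReal ((s / p) ^ p) * ENNReal.ofReal (d ^ (-p)) := by
    rw [ENNReal.ofReal_rpow_of_nonneg (by positivity) hp0.le, ← ENNReal.ofReal_mul (by positivity),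
      ← ENNReal.ofReal_mul (by positivity), Real.mul_rpow (by positivity) (by positivity),
      ← Real.rpow_mul hd.le, mul_assoc, ← Real.rpow_add hd]
    congr 3
    field_simp
    ring
  calc _ ≤ (2 ^ (p - 1) * ((ENNReal.ofReal (d ^ (s / p)) * A) ^ p +
        (ENNReal.ofReal (s / p * d ^ (s / p - 1)) * B) ^ p)) * ENNReal.ofReal (d ^ (-s)) := by
        gcongr
        exact (ENNReal.rpow_le_rpow hG hp0.le).trans
          (ENNReal.rpow_add_le_mul_rpow_add_rpow _ _ hp)
    _ = 2 ^ (p - 1) * ((ENNReal.ofReal (d ^ (s / p)) ^ p * ENNReal.ofReal (d ^ (-s))) * A ^ p +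
        (ENNReal.ofReal (s / p * d ^ (s / p - 1)) ^ p * ENNReal.ofReal (d ^ (-s))) * B ^ p) := by
        rw [ENNReal.mul_rpow_of_nonneg _ _ hp0.le, ENNReal.mul_rpow_of_nonneg _ _ hp0.le]
        ring
    _ = _ := by rw [h1, h2]; ring

/-- For small `s`, the factor gained by the substitution beats the `1 / s` loss. -/
theorem exists_mul_div_rpow_le_half {p : ℝ} (hp : 1 < p) {C : ℝ≥0∞} (hC : C ≠ ⊤) :
    ∃ s : ℝ, 0 < s ∧ s ≤ 1 ∧
      C * ENNReal.ofReal (1 / s) * ENNReal.ofReal ((s / p) ^ p) ≤ 2⁻¹ := by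
  have hp0 : 0 < p := by linarith
  have hlim : Filter.Tendsto (fun s : ℝ => C.toReal * s ^ (p - 1)) (nhdsWithin 0 (Set.Ioi 0))
      (nhds 0) := by
    have := ((Real.continuousAt_rpow_const 0 (p - 1) (Or.inr (by linarith))).tendsto.const_mul
      C.toReal).mono_left (nhdsWithin_le_nhds (s := Set.Ioi 0))
    simpa [Real.zero_rpow (by linarith : p - 1 ≠ 0)] using this
  have h1 : ∀ᶠ s in nhdsWithin (0 : ℝ) (Set.Ioi 0), s ≤ 1 :=
    nhdsWithin_le_nhds (Iic_mem_nhds one_pos)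
  have h0 : ∀ᶠ s in nhdsWithin (0 : ℝ) (Set.Ioi 0), 0 < s := self_mem_nhdsWithin
  obtain ⟨s, hs, hs1, hs0⟩ := ((hlim.eventually
    (Iic_mem_nhds (by norm_num : (0 : ℝ) < 2⁻¹))).and (h1.and h0)).exists
  refine ⟨s, hs0, hs1, ?_⟩
  rw [← ENNReal.ofReal_toReal hC, ← ENNReal.ofReal_mul (by positivity),
    ← ENNReal.ofReal_mul (by positivity), show (2⁻¹ : ℝ≥0∞) = ENNReal.ofReal 2⁻¹ by
      rw [ENNReal.ofReal_inv_of_pos two_pos]; simp]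
  refine ENNReal.ofReal_le_ofReal (le_trans ?_ hs)
  rw [Real.rpow_sub_one hs0.ne', mul_assoc, one_div_mul_eq_div]
  gcongr
  exact div_le_self hs0.le hp.le

/-- The Hardy inequality for bounded open sets with uniformly fat complement, in `ℝ≥0∞`. -/
theorem UniformlyFat.exists_hardy {n : ℕ} [Nontrivial (EuclideanSpace ℝ (Fin n))] {p c₀ r₀ : ℝ}
    {Ω : Set (EuclideanSpace ℝ (Fin n))} (hΩ : UniformlyFat n p c₀ r₀ Ωᶜ) (hopen : IsOpen Ω)
    (hb : Bornology.IsBounded Ω) (hp : 1 < p) (hc₀ : 0 < c₀) (hr₀ : 0 < r₀)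
    (hne : (frontier Ω).Nonempty) :
    ∃ C : ℝ≥0∞, C ≠ ⊤ ∧ ∀ φ : EuclideanSpace ℝ (Fin n) → ℝ, ContDiff ℝ 1 φ →
      HasCompactSupport φ → tsupport φ ⊆ Ω →
      ∫⁻ x in Ω, ‖φ x‖ₑ ^ p * ENNReal.ofReal (infDist x (frontier Ω) ^ (-p)) ≤
        C * ∫⁻ x in Ω, ‖fderiv ℝ φ x‖ₑ ^ p := by
  have hp0 : 0 < p := by linarith
  obtain ⟨C, hC, H⟩ := hΩ.exists_weighted_hardy hopen.isClosed_compl hp.le hc₀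
    (by rwa [frontier_compl])
  rw [compl_compl, frontier_compl] at H
  obtain ⟨s, hs0, hs1, hs⟩ := exists_mul_div_rpow_le_half hp
    (C := C * 2 ^ (p - 1)) (by finiteness)
  obtain ⟨R, hR0, hR⟩ := hb.subset_ball_lt 0 0
  refine ⟨2 * (C * ENNReal.ofReal (1 / s) * 2 ^ (p - 1) +
    ENNReal.ofReal ((r₀ / 4) ^ (-p)) * ENNReal.ofReal (2 * R) ^ p), by finiteness,
    fun φ hφ hc hts => ?_⟩
  set δ : EuclideanSpace ℝ (Fin n) → ℝ := fun x => infDist x (frontier Ω)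
  have hδL : LipschitzWith 1 δ := lipschitz_infDist_pt _
  have hδpos : ∀ x ∈ Ω, 0 < δ x := fun x hx =>
    (isClosed_frontier.notMem_iff_infDist_pos hne).1 fun h => by
      rw [hopen.frontier_eq] at h
      exact h.2 hx
  have hδm : Measurable δ := hδL.continuous.measurable
  obtain ⟨K, hK⟩ := hφ.lipschitzWith_of_hasCompactSupport hc one_ne_zero
  set X := ∫⁻ x in Ω, ‖φ x‖ₑ ^ p * ENNReal.ofReal (δ x ^ (-p)) with hX
  set D := ∫⁻ x in Ω, ‖fderiv ℝ φ x‖ₑ ^ p with hD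
  have hm : Measurable fun x => ‖φ x‖ₑ ^ p * ENNReal.ofReal (δ x ^ (-p)) :=
    (hφ.continuous.measurable.enorm.pow_const p).mul (hδm.pow_const _).ennreal_ofReal
  have hXt : X ≠ ⊤ := by
    obtain ⟨m, hm, hmδ⟩ := hc.exists_forall_le' hδL.continuous.continuousOn
      fun x hx => hδpos x (hts hx)
    obtain ⟨A, hA⟩ := hc.exists_bound_of_continuous hφ.continuous
    refine ((setLIntegral_mono measurable_const fun x _ => ?_).trans_lt
      (?_ : ∫⁻ _ in Ω, ENNReal.ofReal A ^ p * ENNReal.ofReal (m ^ (-p)) < ⊤)).ne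
    · by_cases hx : x ∈ tsupport φ
      · rw [← ofReal_norm]
        exact mul_le_mul' (ENNReal.rpow_le_rpow (ENNReal.ofReal_le_ofReal (hA x)) hp0.le)
          (ENNReal.ofReal_le_ofReal (Real.rpow_le_rpow_of_nonpos hm (hmδ x hx) (by linarith)))
      · simp [image_eq_zero_of_notMem_tsupport hx, hp0]
    · rw [setLIntegral_const]
      have := hb.measure_lt_top (μ := volume)
      finiteness
  have hnear : ∫⁻ x in Ω ∩ {x | δ x < r₀ / 4}, ‖φ x‖ₑ ^ p * ENNReal.ofReal (δ x ^ (-p)) ≤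
      C * ENNReal.ofReal (1 / s) * 2 ^ (p - 1) * D + 2⁻¹ * X := by
    set a := s / p with ha
    have ha0 : 0 ≤ a := by positivity
    have ha1 : a ≤ 1 := (div_le_one hp0).2 (hs1.trans hp.le)
    obtain ⟨L, hL⟩ := hK.exists_lipschitzWith_mul_rpow hc hδL (fun x hx => hδpos x (hts hx)) ha0 ha1
    have hsub : tsupport (fun x => φ x * δ x ^ a) ⊆ tsupport φ :=
      closure_mono (Function.support_mul_subset_left _ _)
    have h1 := H s hs0 hs1 _ L hL (hc.mono' ((subset_tsupport _).trans hsub)) (hsub.trans hts)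
    have h2 : ∫⁻ x in Ω, ‖fderiv ℝ (fun x => φ x * δ x ^ a) x‖ₑ ^ p * ENNReal.ofReal (δ x ^ (-s)) ≤
        2 ^ (p - 1) * (D + ENNReal.ofReal (a ^ p) * X) := by
      rw [hD, hX, ← lintegral_const_mul' _ _ ENNReal.ofReal_ne_top,
        ← lintegral_add_left ((measurable_fderiv ℝ φ).enorm.pow_const p),
        ← lintegral_const_mul' _ _ (by finiteness)]
      refine lintegral_mono_ae ?_
      filter_upwards [ae_restrict_mem hopen.measurableSet,
        ae_restrict_of_ae hδL.ae_differentiableAt] with x hx hδx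
      exact ENNReal.mul_rpow_mul_rpow_le hp.le hs0.le (hδpos x hx)
        (enorm_fderiv_mul_rpow_le hδL (hφ.differentiable one_ne_zero x) hδx (hδpos x hx) ha0)
    have h3 : ∫⁻ x in Ω ∩ {x | δ x < r₀ / 4}, ‖φ x‖ₑ ^ p * ENNReal.ofReal (δ x ^ (-p)) =
        ∫⁻ x in Ω ∩ {x | δ x < r₀ / 4},
          ‖φ x * δ x ^ a‖ₑ ^ p * ENNReal.ofReal (δ x ^ (-(p + s))) := by
      refine setLIntegral_congr_fun (hopen.measurableSet.inter
        (measurableSet_lt hδm measurable_const)) fun x hx => ?_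
      have hx0 := hδpos x hx.1
      rw [enorm_mul, ENNReal.mul_rpow_of_nonneg _ _ hp0.le, mul_assoc,
        Real.enorm_of_nonneg (by positivity : 0 ≤ δ x ^ a),
        ENNReal.ofReal_rpow_of_nonneg (by positivity) hp0.le,
        ← ENNReal.ofReal_mul (by positivity), ← Real.rpow_mul hx0.le, ← Real.rpow_add hx0, ha,
        div_mul_cancel₀ _ hp0.ne']
      congr 4
      ring
    rw [h3]
    calc _ ≤ _ := h1
      _ ≤ C * ENNReal.ofReal (1 / s) * (2 ^ (p - 1) * (D + ENNReal.ofReal (a ^ p) * X)) :=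
          mul_le_mul' le_rfl h2
      _ = C * ENNReal.ofReal (1 / s) * 2 ^ (p - 1) * D +
          C * 2 ^ (p - 1) * ENNReal.ofReal (1 / s) * ENNReal.ofReal (a ^ p) * X := by ring
      _ ≤ _ := by gcongr
  have hfar : ∫⁻ x in Ω \ {x | δ x < r₀ / 4}, ‖φ x‖ₑ ^ p * ENNReal.ofReal (δ x ^ (-p)) ≤
      ENNReal.ofReal ((r₀ / 4) ^ (-p)) * ENNReal.ofReal (2 * R) ^ p * D := by
    have hFr := hK.lintegral_enorm_rpow_le_of_eq_zero volume hp.le hR0.le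
      fun x hx => image_eq_zero_of_notMem_tsupport fun h => hx (hR (hts h))
    have hsupp : ∫⁻ x, ‖fderiv ℝ φ x‖ₑ ^ p = D := by
      rw [hD, ← lintegral_indicator hopen.measurableSet, Set.indicator_eq_self.2]
      refine fun x hx => hts (support_fderiv_subset ℝ fun h => hx ?_)
      change ‖fderiv ℝ φ x‖ₑ ^ p = 0
      rw [← ofReal_norm, h, norm_zero, ENNReal.ofReal_zero, ENNReal.zero_rpow_of_pos hp0]
    rw [hsupp] at hFr
    rw [mul_assoc]
    refine le_trans ?_ (mul_le_mul' le_rfl hFr)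
    rw [← lintegral_const_mul' _ _ ENNReal.ofReal_ne_top]
    refine (setLIntegral_mono' (hopen.measurableSet.diff
      (measurableSet_lt hδm measurable_const)) fun x hx => ?_).trans (setLIntegral_le_lintegral _ _)
    rw [mul_comm]
    exact mul_le_mul' (ENNReal.ofReal_le_ofReal
      (Real.rpow_le_rpow_of_nonpos (by positivity) (not_lt.1 hx.2) (by linarith))) le_rfl
  have hsplit := lintegral_inter_add_sdiff (μ := volume)
    (fun x => ‖φ x‖ₑ ^ p * ENNReal.ofReal (δ x ^ (-p))) Ω
    (measurableSet_lt hδm (measurable_const (a := r₀ / 4)))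
  have hsum : 2⁻¹ * X + 2⁻¹ * X ≤ (C * ENNReal.ofReal (1 / s) * 2 ^ (p - 1) +
      ENNReal.ofReal ((r₀ / 4) ^ (-p)) * ENNReal.ofReal (2 * R) ^ p) * D + 2⁻¹ * X := by
    rw [← add_mul, ENNReal.inv_two_add_inv_two, one_mul]
    calc X ≤ _ := hsplit.ge.trans (add_le_add hnear hfar)
      _ = _ := by ring
  rw [ENNReal.add_le_add_iff_right (by finiteness)] at hsum
  calc X = 2 * (2⁻¹ * X) := by
        rw [← mul_assoc, ENNReal.mul_inv_cancel two_ne_zero (by norm_num), one_mul]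
    _ ≤ _ := mul_le_mul' le_rfl hsum
    _ = _ := by ring

/-- **Hardy inequality for fat complements** (Theorem 4.1, Euclidean case): if `ℝⁿ∖Ω` is
uniformly `p`-fat, then `∫_Ω |φ|^p δ^{-p} ≤ C ∫_Ω |∇φ|^p` for all `φ ∈ C_c^∞(Ω)`. -/
theorem hardy_fat_complement (n : ℕ) (hn : 3 ≤ n) (p : ℝ) (hp : 1 < p)
    (Ω : Set (EuclideanSpace ℝ (Fin n)))
    (hb : Bornology.IsBounded Ω) (hconn : IsConnected Ω) (hopen : IsOpen Ω)
    (c₀ r₀ : ℝ) (hc₀ : 0 < c₀) (hr₀ : 0 < r₀) (hfat : UniformlyFat n p c₀ r₀ Ωᶜ) :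
    ∃ C : ℝ, 0 < C ∧
      ∀ φ : EuclideanSpace ℝ (Fin n) → ℝ, ContDiff ℝ (⊤ : ℕ∞) φ → HasCompactSupport φ →
        tsupport φ ⊆ Ω →
        (∫ x in Ω, |φ x| ^ p * Metric.infDist x (frontier Ω) ^ (-p)) ≤
          C * ∫ x in Ω, ‖fderiv ℝ φ x‖ ^ p := by
  have hp0 : 0 < p := by linarith
  have : Nonempty (Fin n) := ⟨⟨0, by omega⟩⟩
  have hne : (frontier Ω).Nonempty := by
    refine nonempty_frontier_iff.2 ⟨hconn.nonempty, fun h => ?_⟩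
    exact NormedSpace.unbounded_univ ℝ (EuclideanSpace ℝ (Fin n)) (h ▸ hb)
  obtain ⟨C, hC, H⟩ := hfat.exists_hardy hopen hb hp hc₀ hr₀ hne
  refine ⟨C.toReal + 1, by positivity, fun φ hφ hc hts => ?_⟩
  have hφ1 : ContDiff ℝ 1 φ := hφ.of_le (by exact_mod_cast le_top)
  have h := H φ hφ1 hc hts
  obtain ⟨K, hK⟩ := hφ1.lipschitzWith_of_hasCompactSupport hc one_ne_zero
  have hfin : ∫⁻ x in Ω, ‖fderiv ℝ φ x‖ₑ ^ p ≠ ⊤ := by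
    refine ((setLIntegral_mono measurable_const fun x _ => ?_).trans_lt
      (?_ : ∫⁻ _ in Ω, (K : ℝ≥0∞) ^ p < ⊤)).ne
    · gcongr
      exact_mod_cast norm_fderiv_le_of_lipschitz ℝ hK
    · rw [setLIntegral_const]
      have := hb.measure_lt_top (μ := volume)
      finiteness
  have hm : Measurable fun x => |φ x| ^ p * Metric.infDist x (frontier Ω) ^ (-p) :=
    (hφ.continuous.measurable.abs.pow_const p).mul
      ((continuous_infDist_pt _).measurable.pow_const _)
  rw [integral_norm_rpow_eq_toReal_lintegral (measurable_fderiv ℝ φ).aestronglyMeasurable hp0.le,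
    integral_eq_lintegral_of_nonneg_ae
      (.of_forall fun x => mul_nonneg (by positivity) (Real.rpow_nonneg infDist_nonneg _))
      hm.aestronglyMeasurable]
  have hcongr : ∫⁻ x in Ω, ENNReal.ofReal (|φ x| ^ p * Metric.infDist x (frontier Ω) ^ (-p)) =
      ∫⁻ x in Ω, ‖φ x‖ₑ ^ p * ENNReal.ofReal (infDist x (frontier Ω) ^ (-p)) := by
    refine lintegral_congr fun x => ?_
    rw [ENNReal.ofReal_mul (by positivity), ← ENNReal.ofReal_rpow_of_nonneg (abs_nonneg _) hp0.le,
      ← Real.norm_eq_abs, ofReal_norm]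
  rw [hcongr]
  refine (ENNReal.toReal_mono (ENNReal.mul_ne_top hC hfin) h).trans ?_
  rw [ENNReal.toReal_mul]
  gcongr
  linarith
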